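/- arXiv:1412.3006 — 2 statements merged into one kernel-verified Lean document; each statement's English description precedes it below -/
import Mathlib

section
/- For every n of the form 2^k − 1 with n ≥ 15, there exists a reduced perfect binary code of length n that is homogeneous but not transitive. -/
set_option linter.unusedSectionVars false

/-- Binary vectors of length `|ι|`, indexed by `ι`. -/
abbrev F (ι : Type*) : Type _ := ι → ZMod 2

section Defs

variable {ι : Type*}

/-- The support of a vector: the set of its nonzero coordinate positions. -/
def supp (x : F ι) : Set ι := {i | x i ≠ 0}

/-- Action of a permutation on binary vectors by permuting coordinates:
`(permAct π x) (π i) = x i`. -/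
def permAct (π : Equiv.Perm ι) (x : F ι) : F ι := x ∘ π.symm

/-- The image `π(C)` of a code under a coordinate permutation. -/
def permCode (π : Equiv.Perm ι) (C : Set (F ι)) : Set (F ι) := permAct π '' C

/-- The translateCode `y + C` of a code. -/
def translateCode (y : F ι) (C : Set (F ι)) : Set (F ι) := (y + ·) '' C

/-- `Sym(C) = {π : π(C) = C}`. -/
def SymSet (C : Set (F ι)) : Set (Equiv.Perm ι) := {π | permCode π C = C}

/-- `Rot(C) = {π : ∃ y ∈ C, y + π(C) = C}`. -/
def RotSet (C : Set (F ι)) : Set (Equiv.Perm ι) :=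
  {π | ∃ y ∈ C, translateCode y (permCode π C) = C}

/-- `Rot_y(C) = {π : y + π(C) = C}`. -/
def RotAt (C : Set (F ι)) (y : F ι) : Set (Equiv.Perm ι) :=
  {π | translateCode y (permCode π C) = C}

/-- `Tr(C) = {y ∈ C : ∃ π, y + π(C) = C}`. -/
def TrSet (C : Set (F ι)) : Set (F ι) :=
  {y | y ∈ C ∧ ∃ π : Equiv.Perm ι, translateCode y (permCode π C) = C}

/-- `Ker(C) = {x ∈ C : x + C = C}`. -/
def KerSet (C : Set (F ι)) : Set (F ι) := {x | x ∈ C ∧ translateCode x C = C}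

/-- `Aut(C) = {(y, π) : y + π(C) = C}`. -/
def AutSet (C : Set (F ι)) : Set (F ι × Equiv.Perm ι) :=
  {p | translateCode p.1 (permCode p.2 C) = C}

/-- A (reduced) code is transitive if for every codeword `y` there is a permutation `π`
with `y + π(C) = C`. -/
def IsTransitive (C : Set (F ι)) : Prop :=
  ∀ y ∈ C, ∃ π : Equiv.Perm ι, translateCode y (permCode π C) = C

/-- A code is propelinear if `Aut(C)` contains a subgroup acting regularly on `C`
(the group law is `(y, π) * (y', π') = (y + π(y'), π ∘ π')`, acting by `(y,π) • x = y + π(x)`). -/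
def IsPropelinear (C : Set (F ι)) : Prop :=
  ∃ A : Set (F ι × Equiv.Perm ι),
    (∀ a ∈ A, translateCode a.1 (permCode a.2 C) = C) ∧
    ((0, 1) ∈ A) ∧
    (∀ a ∈ A, ∀ b ∈ A, (a.1 + permAct a.2 b.1, a.2 * b.2) ∈ A) ∧
    (∀ a ∈ A, (permAct a.2⁻¹ a.1, a.2⁻¹) ∈ A) ∧
    (∀ c ∈ C, ∀ c' ∈ C, ∃! a, a ∈ A ∧ a.1 + permAct a.2 c = c')

variable [Fintype ι] [DecidableEq ι]

/-- A perfect (1-error-correcting) code: every vector is within Hamming distance 1 of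
exactly one codeword. -/
def IsPerfect (C : Set (F ι)) : Prop :=
  ∀ x : F ι, ∃! c, c ∈ C ∧ hammingDist x c ≤ 1

/-- `STS(C, y) = {supp (x + y) : x ∈ C, d(x, y) = 3}`. -/
def STS (C : Set (F ι)) (y : F ι) : Set (Set ι) :=
  {s | ∃ x ∈ C, hammingDist x y = 3 ∧ s = supp (x + y)}

/-- A reduced perfect code is homogeneous if each `STS(C,y)`, `y ∈ C`, is isomorphic
to `STS(C, 0)`. -/
def IsHomogeneous (C : Set (F ι)) : Prop :=
  ∀ y ∈ C, ∃ π : Equiv.Perm ι, (Set.image π) '' (STS C y) = STS C (0 : F ι)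

/-- The (mod 2) weight `|x| = x_1 + ⋯ + x_n`. -/
def wt (x : F ι) : ZMod 2 := ∑ i, x i

/-- The scalar product `u · y = Σ u_i y_i (mod 2)`. -/
def dot (u y : F ι) : ZMod 2 := ∑ i, u i * y i

/-- A linear code: a subspace of `F ι` (over `ZMod 2` it suffices to be closed under `+`). -/
def IsLinearCode (C : Set (F ι)) : Prop :=
  (0 : F ι) ∈ C ∧ ∀ x ∈ C, ∀ y ∈ C, x + y ∈ C

/-- A Hamming code: a linear perfect code. -/
def IsHammingCode (C : Set (F ι)) : Prop := IsLinearCode C ∧ IsPerfect C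

/-- The `i`-component `R_i`: the linear span of the weight-3 codewords of `H` whose
support contains `i`. -/
def component (H : Set (F ι)) (i : ι) : Set (F ι) :=
  ↑(Submodule.span (ZMod 2) {x | x ∈ H ∧ hammingNorm x = 3 ∧ x i ≠ 0})

/-- `lam` pierces `R` if it takes both values 0 and 1 on `R`. -/
def Pierces (lam : F ι → ZMod 2) (R : Set (F ι)) : Prop :=
  (∃ x ∈ R, lam x = 0) ∧ (∃ x ∈ R, lam x = 1)

/-- The vector `(a, b, c)` of length `2n+1`: coordinates `1..n` are `a`, coordinate `n+1`
is `b`, coordinates `n+2..2n+1` are `c`. -/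
def vasVec (a : F ι) (b : ZMod 2) (c : F ι) : F (ι ⊕ Unit ⊕ ι) :=
  Sum.elim a (Sum.elim (fun _ => b) c)

/-- The Vasil'ev code `V_C^λ = {(x + y, |x| + λ(y), x) : x ∈ F^n, y ∈ C}`. -/
def Vasiliev (C : Set (F ι)) (lam : F ι → ZMod 2) : Set (F (ι ⊕ Unit ⊕ ι)) :=
  {v | ∃ x : F ι, ∃ y ∈ C, v = vasVec (x + y) (wt x + lam y) x}

/-- The subspace `R_{n+1}^{2n+1} = {(x, |x|, x) : x ∈ F^n}`. -/
def Rmid : Set (F (ι ⊕ Unit ⊕ ι)) := {v | ∃ x : F ι, v = vasVec x (wt x) x}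

/-- Underlying function of `τ_u`: swaps positions `i` and `i + n + 1` for `i ∈ supp u`. -/
def tauFun (u : F ι) : (ι ⊕ Unit ⊕ ι) → (ι ⊕ Unit ⊕ ι)
  | Sum.inl i => if u i ≠ 0 then Sum.inr (Sum.inr i) else Sum.inl i
  | Sum.inr (Sum.inl _) => Sum.inr (Sum.inl ())
  | Sum.inr (Sum.inr i) => if u i ≠ 0 then Sum.inl i else Sum.inr (Sum.inr i)

theorem tauFun_involutive (u : F ι) : Function.Involutive (tauFun u) := by
  intro x
  rcases x with i | x
  · by_cases h : u i = 0 <;> simp [tauFun, h]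
  · rcases x with u' | i
    · simp [tauFun]
    · by_cases h : u i = 0 <;> simp [tauFun, h]

/-- The permutation `τ_u`: the product of transpositions `(i, i+n+1)` over `i ∈ supp u`. -/
def tau (u : F ι) : Equiv.Perm (ι ⊕ Unit ⊕ ι) :=
  Function.Involutive.toPerm (tauFun u) (tauFun_involutive u)

/-- The duplicator `σ_π`: fixes position `n+1`, sends `i ↦ π(i)` and `i+n+1 ↦ π(i)+n+1`. -/
def dup (π : Equiv.Perm ι) : Equiv.Perm (ι ⊕ Unit ⊕ ι) :=
  Equiv.sumCongr π (Equiv.sumCongr (Equiv.refl Unit) π)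

/-- The extension of `λ` one step up the Vasil'ev recursion: `λ'(z) = λ(y)` for
`z ∈ (y, 0^{m+1}) + R_{m+1}^{2m+1}` (well defined by recovering `y` from `z`). -/
def lamSucc (lam : F ι → ZMod 2) : F (ι ⊕ Unit ⊕ ι) → ZMod 2 :=
  fun z => lam (fun i => z (Sum.inl i) + z (Sum.inr (Sum.inr i)))

/-- `T = {y' ∈ H : (y', λ(y'), 0) ∈ Tr(V_H^λ)}`. -/
def Tset (H : Set (F ι)) (lam : F ι → ZMod 2) : Set (F ι) :=
  {y' | y' ∈ H ∧ vasVec y' (lam y') 0 ∈ TrSet (Vasiliev H lam)}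

/-- The Assmus–Mattson Steiner triple system `S^θ` of order `2n+1`. -/
def AM (S : Set (Set ι)) (θ : Set ι → ZMod 2) : Set (Set (ι ⊕ Unit ⊕ ι)) :=
  {T | (∃ i : ι, T = {Sum.inl i, Sum.inr (Sum.inl ()), Sum.inr (Sum.inr i)}) ∨
    (∃ s ∈ S, θ s = 0 ∧
      (T = Sum.inl '' s ∨
        ∃ a ∈ s, T = insert (Sum.inl a) ((fun i => Sum.inr (Sum.inr i)) '' (s \ {a})))) ∨
    (∃ s ∈ S, θ s = 1 ∧
      (T = (fun i => Sum.inr (Sum.inr i)) '' s ∨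
        ∃ a ∈ s, T = insert (Sum.inr (Sum.inr a)) (Sum.inl '' (s \ {a}))))}

end Defs

/-- A Steiner triple system on the point set `α`. -/
def IsSTS {α : Type*} (S : Set (Set α)) : Prop :=
  (∀ s ∈ S, s.ncard = 3) ∧ ∀ i j : α, i ≠ j → ∃! s, s ∈ S ∧ i ∈ s ∧ j ∈ s

/-- The Mollard code (with zero function) of the codes `C` and `D`. -/
def Mollard {t r : Type*} [Fintype t] [Fintype r] (C : Set (F t)) (D : Set (F r)) :
    Set (F ((t × r) ⊕ t ⊕ r)) :=
  {v | ∃ x : F (t × r), ∃ c ∈ C, ∃ d ∈ D,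
    v = Sum.elim x (Sum.elim (fun i => c i + ∑ j, x (i, j)) (fun j => d j + ∑ i, x (i, j)))}

/-- Index types of the iterated Vasil'ev construction: lengths `n`, `2n+1`, `4n+3`, …. -/
def HType (n : ℕ) : ℕ → Type
  | 0 => Fin n
  | s + 1 => HType n s ⊕ Unit ⊕ HType n s

def HType.ft (n : ℕ) : ∀ s, Fintype (HType n s)
  | 0 => inferInstanceAs (Fintype (Fin n))
  | s + 1 =>
      letI := HType.ft n s
      inferInstanceAs (Fintype (HType n s ⊕ Unit ⊕ HType n s))

instance (n s : ℕ) : Fintype (HType n s) := HType.ft n s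

def HType.deq (n : ℕ) : ∀ s, DecidableEq (HType n s)
  | 0 => inferInstanceAs (DecidableEq (Fin n))
  | s + 1 =>
      letI := HType.deq n s
      inferInstanceAs (DecidableEq (HType n s ⊕ Unit ⊕ HType n s))

instance (n s : ℕ) : DecidableEq (HType n s) := HType.deq n s

/-- The iterated Hamming codes `H^n, H^{2n+1} = V_{H^n}^0, H^{4n+3}, …`. -/
def Hcode (n : ℕ) (H : Set (F (Fin n))) : ∀ s, Set (F (HType n s))
  | 0 => H
  | s + 1 => Vasiliev (Hcode n H s) 0

/-- The iterated functions `λ_n = λ`, `λ_{2m+1}` extending `λ_m`. -/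
def lamIter (n : ℕ) (lam : F (Fin n) → ZMod 2) : ∀ s, F (HType n s) → ZMod 2
  | 0 => lam
  | s + 1 => lamSucc (lamIter n lam s)

/-- `C_0 = V_{H^n}^λ`, `C_{s+1} = V_{C_s}^0`. -/
def Ccode (n : ℕ) (H : Set (F (Fin n))) (lam : F (Fin n) → ZMod 2) :
    ∀ s, Set (F (HType n (s + 1)))
  | 0 => Vasiliev H lam
  | s + 1 => Vasiliev (Ccode n H lam s) 0


section Perfect

variable {ι : Type*} [DecidableEq ι]

/-- The error patterns of weight at most one. -/
def errVec (o : Option ι) : F ι := fun i => if o = some i then 1 else 0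

theorem errVec_injective : Function.Injective (errVec : Option ι → F ι) := by
  intro o o' h
  have key : ∀ i, o = some i ↔ o' = some i := by
    intro i
    have := congrFun h i
    simp only [errVec] at this
    split_ifs at this <;> simp_all
  cases o with
  | some i => exact ((key i).1 rfl).symm
  | none =>
    cases o' with
    | none => rfl
    | some j => exact (key j).2 rfl

variable [Fintype ι]

theorem hammingDist_le_one_iff (x c : F ι) :
    hammingDist x c ≤ 1 ↔ ∃ o, c = x + errVec o := by
  have hne : ∀ a b : ZMod 2, a ≠ b → b = a + 1 := by decide
  rw [hammingDist, Finset.card_le_one]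
  simp only [Finset.mem_filter, Finset.mem_univ, true_and]
  constructor
  · intro h
    by_cases hxc : x = c
    · exact ⟨none, funext fun j => by simp [errVec, hxc]⟩
    · obtain ⟨i, hi⟩ := Function.ne_iff.1 hxc
      refine ⟨some i, funext fun j => ?_⟩
      by_cases hj : i = j
      · subst hj
        simp [errVec, hne _ _ hi]
      · have : x j = c j := by
          by_contra hxj
          exact hj (h i hi j hxj)
        simp [errVec, this, hj]
  · rintro ⟨o, rfl⟩ i hi j hj
    have key : ∀ k, x k ≠ (x + errVec o) k → o = some k := by
      intro k hk
      by_contra hok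
      exact hk (by simp [errVec, hok])
    exact Option.some.inj ((key i hi).symm.trans (key j hj))

theorem isPerfect_iff (C : Set (F ι)) :
    IsPerfect C ↔ ∀ x, ∃! o, x + errVec o ∈ C := by
  refine forall_congr' fun x => ?_
  constructor
  · rintro ⟨c, ⟨hc, hd⟩, hu⟩
    obtain ⟨o, rfl⟩ := (hammingDist_le_one_iff x c).1 hd
    refine ⟨o, hc, fun o' ho' => errVec_injective (add_left_cancel (a := x) ?_)⟩
    exact hu _ ⟨ho', (hammingDist_le_one_iff _ _).2 ⟨o', rfl⟩⟩
  · rintro ⟨o, ho, hu⟩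
    refine ⟨x + errVec o, ⟨ho, (hammingDist_le_one_iff _ _).2 ⟨o, rfl⟩⟩, ?_⟩
    rintro c ⟨hc, hd⟩
    obtain ⟨o', rfl⟩ := (hammingDist_le_one_iff x c).1 hd
    rw [hu o' hc]

end Perfect

section Local

variable {ι : Type*} [Fintype ι]

/-- Around every codeword, the code agrees up to distance three with the code around `0`,
up to a permutation of the coordinates. -/
def IsLocallyHomogeneous (C : Set (F ι)) : Prop :=
  ∀ y ∈ C, ∃ π : Equiv.Perm ι, ∀ v : F ι, hammingNorm v ≤ 3 → (y + v ∈ C ↔ v ∘ π ∈ C)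

/-- There are four codewords within distance three of `y` such that no two of them complete
`y` to a parallelogram in the code. -/
def HasIndependentQuadruple (C : Set (F ι)) (y : F ι) : Prop :=
  ∃ T : Fin 4 → F ι, (∀ i, hammingNorm (T i) ≤ 3 ∧ y + T i ∈ C) ∧
    ∀ i j, i ≠ j → y + (T i + T j) ∉ C

theorem hammingNorm_comp_equiv {κ : Type*} [Fintype κ] (e : κ ≃ ι) (v : F ι) :
    hammingNorm (v ∘ e) = hammingNorm v := by
  simp only [hammingNorm, ← Fintype.card_subtype]
  exact Fintype.card_congr (e.subtypeEquiv fun _ => Iff.rfl)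

theorem add_add_cancel_self (y v : F ι) : y + (y + v) = v := by
  funext i
  simp [← add_assoc, CharTwo.add_self_eq_zero]

theorem hammingDist_eq_hammingNorm_add (x y : F ι) : hammingDist x y = hammingNorm (x + y) := by
  have h : ∀ a b : ZMod 2, a ≠ b ↔ a + b ≠ 0 := by decide
  exact congrArg Finset.card (Finset.filter_congr fun i _ => h _ _)

theorem mem_STS_iff (C : Set (F ι)) (y : F ι) (s : Set ι) :
    s ∈ STS C y ↔ ∃ v, y + v ∈ C ∧ hammingNorm v = 3 ∧ s = supp v := by
  constructor
  · rintro ⟨x, hx, hd, rfl⟩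
    refine ⟨x + y, ?_, by rwa [← hammingDist_eq_hammingNorm_add], rfl⟩
    rwa [add_comm x y, add_add_cancel_self]
  · rintro ⟨v, hv, hd, rfl⟩
    have : y + v + y = v := by rw [add_comm, add_add_cancel_self]
    exact ⟨y + v, hv, by rwa [hammingDist_eq_hammingNorm_add, this], by rw [this]⟩

theorem IsLocallyHomogeneous.isHomogeneous {C : Set (F ι)} (hC : IsLocallyHomogeneous C) :
    IsHomogeneous C := by
  intro y hy
  obtain ⟨π, hπ⟩ := hC y hy
  have hsupp : ∀ v : F ι, π.symm '' supp v = supp (v ∘ π) := by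
    intro v
    rw [Equiv.image_symm_eq_preimage]
    rfl
  refine ⟨π.symm, Set.ext fun s => ?_⟩
  simp only [Set.mem_image, mem_STS_iff, zero_add]
  constructor
  · rintro ⟨_, ⟨v, hv, hd, rfl⟩, rfl⟩
    exact ⟨v ∘ π, (hπ v hd.le).1 hv, by rwa [hammingNorm_comp_equiv], hsupp v⟩
  · rintro ⟨v, hv, hd, rfl⟩
    have hcomp : (v ∘ π.symm) ∘ π = v := by
      funext i
      simp
    have hd' : hammingNorm (v ∘ π.symm) = 3 := by rwa [hammingNorm_comp_equiv]
    refine ⟨_, ⟨v ∘ π.symm, (hπ _ hd'.le).2 (by rwa [hcomp]), hd', rfl⟩, ?_⟩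
    rw [hsupp, hcomp]

theorem HasIndependentQuadruple.zero_of_translateCode {C : Set (F ι)} {y : F ι}
    (hy : HasIndependentQuadruple C y) {π : Equiv.Perm ι}
    (h : translateCode y (permCode π C) = C) : HasIndependentQuadruple C 0 := by
  have key : ∀ v : F ι, y + v ∈ C ↔ v ∘ π ∈ C := by
    intro v
    rw [← h]
    constructor
    · rintro ⟨_, ⟨c, hc, rfl⟩, hcv⟩
      have : permAct π c = v := add_left_cancel hcv
      rw [h, ← this]
      simpa [permAct, Function.comp_assoc] using hc
    · intro hv
      rw [h] at hv
      exact ⟨v, ⟨v ∘ π, hv, by simp [permAct, Function.comp_assoc]⟩, rfl⟩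
  obtain ⟨T, hT, hT'⟩ := hy
  refine ⟨fun i => T i ∘ π, fun i => ⟨?_, ?_⟩, fun i j hij => ?_⟩
  · rw [hammingNorm_comp_equiv]; exact (hT i).1
  · rw [zero_add]; exact (key _).1 (hT i).2
  · rw [zero_add]; exact fun hc => hT' i j hij ((key (T i + T j)).2 hc)

variable [DecidableEq ι]

/-- A sufficient condition for a code to be homogeneous but not transitive, stable under the
Vasil'ev doubling with the zero function. -/
structure IsWitness (C : Set (F ι)) : Prop where
  zero_mem : (0 : F ι) ∈ C
  isPerfect : IsPerfect C
  isLocallyHomogeneous : IsLocallyHomogeneous C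
  exists_quadruple : ∃ y ∈ C, HasIndependentQuadruple C y
  not_quadruple_zero : ¬ HasIndependentQuadruple C 0

theorem IsWitness.not_isTransitive {C : Set (F ι)} (hC : IsWitness C) : ¬ IsTransitive C := by
  intro h
  obtain ⟨y, hy, hq⟩ := hC.exists_quadruple
  obtain ⟨π, hπ⟩ := h y hy
  exact hC.not_quadruple_zero (hq.zero_of_translateCode hπ)

theorem IsWitness.comp {κ : Type*} [Fintype κ] [DecidableEq κ] {C : Set (F ι)}
    (hC : IsWitness C) (e : ι ≃ κ) : IsWitness {x : F κ | x ∘ e ∈ C} where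
  zero_mem := hC.zero_mem
  isPerfect := by
    rw [isPerfect_iff]
    intro x
    have h := (isPerfect_iff C).1 hC.isPerfect (x ∘ e)
    rw [(Equiv.optionCongr e).existsUnique_congr (q := fun o => x + errVec o ∈ {x | x ∘ e ∈ C})] at h
    · exact h
    · intro o
      have : (x + errVec (e.optionCongr o)) ∘ e = x ∘ e + errVec o := by
        funext i
        cases o <;> simp [errVec]
      rw [Set.mem_ofPred_eq, this]
  isLocallyHomogeneous := by
    intro y hy
    obtain ⟨π, hπ⟩ := hC.isLocallyHomogeneous (y ∘ e) hy
    refine ⟨(e.symm.trans π).trans e, fun v hv => ?_⟩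
    have := hπ (v ∘ e) (by rwa [hammingNorm_comp_equiv])
    have h2 : (v ∘ ((e.symm.trans π).trans e)) ∘ e = (v ∘ e) ∘ π := by
      funext i; simp
    rw [Set.mem_ofPred_eq, Set.mem_ofPred_eq, h2]
    exact this
  exists_quadruple := by
    obtain ⟨y, hy, T, hT, hT'⟩ := hC.exists_quadruple
    have hcomp : ∀ x : F ι, (x ∘ e.symm) ∘ e = x := fun x => by funext i; simp
    refine ⟨y ∘ e.symm, by rwa [Set.mem_ofPred_eq, hcomp], fun i => T i ∘ e.symm,
      fun i => ⟨?_, ?_⟩, fun i j hij => ?_⟩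
    · rw [hammingNorm_comp_equiv]; exact (hT i).1
    · have := (hT i).2
      rwa [← hcomp (y + T i)] at this
    · have := hT' i j hij
      rwa [← hcomp (y + (T i + T j))] at this
  not_quadruple_zero := by
    rintro ⟨T, hT, hT'⟩
    refine hC.not_quadruple_zero ⟨fun i => T i ∘ e, fun i => ⟨?_, (hT i).2⟩, hT'⟩
    rw [hammingNorm_comp_equiv]; exact (hT i).1

end Local

section Vasiliev

variable {ι : Type*}

/-- The sum of the two halves of a vector. -/
def fold (v : F (ι ⊕ Unit ⊕ ι)) : F ι := fun i => v (Sum.inl i) + v (Sum.inr (Sum.inr i))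

theorem fold_add (v w : F (ι ⊕ Unit ⊕ ι)) : fold (v + w) = fold v + fold w := by
  funext i
  simp only [fold, Pi.add_apply]
  ring

theorem fold_vasVec (a c : F ι) (b : ZMod 2) : fold (vasVec a b c) = a + c := rfl

variable [Fintype ι]

theorem wt_add (x y : F ι) : wt (x + y) = wt x + wt y := Finset.sum_add_distrib

theorem wt_right_add (v w : F (ι ⊕ Unit ⊕ ι)) :
    wt (fun i => (v + w) (Sum.inr (Sum.inr i))) =
      wt (fun i => v (Sum.inr (Sum.inr i))) + wt (fun i => w (Sum.inr (Sum.inr i))) :=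
  wt_add _ _

theorem mem_vasiliev_iff (C : Set (F ι)) (lam : F ι → ZMod 2) (v : F (ι ⊕ Unit ⊕ ι)) :
    v ∈ Vasiliev C lam ↔ fold v ∈ C ∧
      v (Sum.inr (Sum.inl ())) = wt (fun i => v (Sum.inr (Sum.inr i))) + lam (fold v) := by
  constructor
  · rintro ⟨x, y, hy, rfl⟩
    have : fold (vasVec (x + y) (wt x + lam y) x) = y := by
      rw [fold_vasVec, add_comm, add_add_cancel_self]
    rw [this]
    exact ⟨hy, rfl⟩
  · rintro ⟨hC, hb⟩
    refine ⟨fun i => v (Sum.inr (Sum.inr i)), fold v, hC, ?_⟩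
    rw [← hb]
    funext i
    rcases i with i | i | i
    · simp only [vasVec, Sum.elim_inl, Pi.add_apply, fold]
      rw [add_left_comm, CharTwo.add_self_eq_zero, add_zero]
    · rfl
    · rfl

theorem hammingNorm_fold_le (v : F (ι ⊕ Unit ⊕ ι)) : hammingNorm (fold v) ≤ hammingNorm v := by
  classical
  let g : ι ⊕ Unit ⊕ ι → Option ι := Sum.elim some (Sum.elim (fun _ => none) some)
  rw [hammingNorm, hammingNorm, ← Finset.card_map Function.Embedding.some]
  refine (Finset.card_le_card ?_).trans (Finset.card_image_le (f := g))
  intro o ho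
  simp only [Finset.mem_map, Finset.mem_filter, Finset.mem_univ, true_and] at ho
  obtain ⟨i, hi, rfl⟩ := ho
  rw [Finset.mem_image]
  by_cases h : v (Sum.inl i) = 0
  · refine ⟨Sum.inr (Sum.inr i), ?_, rfl⟩
    simpa [fold, h] using hi
  · exact ⟨Sum.inl i, by simpa using h, rfl⟩

variable [DecidableEq ι]

/-- Folding an error pattern. -/
def foldErr : Option (ι ⊕ Unit ⊕ ι) → Option ι
  | some (Sum.inl i) => some i
  | some (Sum.inr (Sum.inr i)) => some i
  | _ => none

theorem fold_errVec (o : Option (ι ⊕ Unit ⊕ ι)) : fold (errVec o) = errVec (foldErr o) := by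
  funext i
  rcases o with _ | i | i | i <;> simp [fold, errVec, foldErr]

theorem IsPerfect.vasiliev {C : Set (F ι)} (hC : IsPerfect C) (lam : F ι → ZMod 2) :
    IsPerfect (Vasiliev C lam) := by
  rw [isPerfect_iff] at hC ⊢
  intro x
  obtain ⟨o, ho, hu⟩ := hC (fold x)
  have hmem : ∀ p : Option (ι ⊕ Unit ⊕ ι), x + errVec p ∈ Vasiliev C lam ↔ foldErr p = o ∧
      x (Sum.inr (Sum.inl ())) + errVec p (Sum.inr (Sum.inl ())) =
        wt (fun i => x (Sum.inr (Sum.inr i))) + wt (fun i => errVec p (Sum.inr (Sum.inr i))) +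
          lam (fold x + errVec o) := by
    intro p
    rw [mem_vasiliev_iff, fold_add, fold_errVec, ← wt_add]
    constructor
    · rintro ⟨h1, h2⟩
      have := hu _ h1
      subst this
      exact ⟨rfl, h2⟩
    · rintro ⟨rfl, h2⟩
      exact ⟨ho, h2⟩
  simp only [hmem]
  generalize x (Sum.inr (Sum.inl ())) = b
  generalize wt (fun i => x (Sum.inr (Sum.inr i))) = c
  generalize lam (fold x + errVec o) = l
  have hz : ∀ a b : ZMod 2, a = b ∧ a + 1 ≠ b ∨ a + 1 = b ∧ a ≠ b := by decide
  have hadd : ∀ a b : ZMod 2, a = b + 1 ↔ a + 1 = b := by decide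
  rcases o with _ | i
  · rcases hz b (c + l) with ⟨h, h'⟩ | ⟨h, h'⟩
    · refine ⟨none, by simpa [foldErr, errVec, wt] using h, ?_⟩
      rintro (_ | j | j | j) <;> simp_all [foldErr, errVec, wt]
    · refine ⟨some (Sum.inr (Sum.inl ())), by simpa [foldErr, errVec, wt] using h, ?_⟩
      rintro (_ | j | j | j) <;> simp_all [foldErr, errVec, wt]
  · rcases hz b (c + l) with ⟨h, h'⟩ | ⟨h, h'⟩
    · refine ⟨some (Sum.inl i), by simpa [foldErr, errVec, wt] using h, ?_⟩
      rintro (_ | j | j | j) <;> simp_all [foldErr, errVec, wt, add_right_comm c 1 l]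
    · refine ⟨some (Sum.inr (Sum.inr i)),
        by simpa [foldErr, errVec, wt, add_right_comm c 1 l, hadd] using h, ?_⟩
      rintro (_ | j | j | j) <;> simp_all [foldErr, errVec, wt]

theorem IsLocallyHomogeneous.vasiliev {C : Set (F ι)} {lam : F ι → ZMod 2}
    (h : ∀ y ∈ C, ∃ (π : Equiv.Perm ι) (u : F ι), ∀ z : F ι, hammingNorm z ≤ 3 →
      (y + z ∈ C ↔ z ∘ π ∈ C) ∧ (y + z ∈ C → lam (y + z) + lam y = dot u z + lam (z ∘ π))) :
    IsLocallyHomogeneous (Vasiliev C lam) := by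
  intro w hw
  rw [mem_vasiliev_iff] at hw
  obtain ⟨hwC, hwb⟩ := hw
  obtain ⟨π, u, hπ⟩ := h _ hwC
  refine ⟨(dup π).trans (tau u), fun v hv => ?_⟩
  obtain ⟨h1, h2⟩ := hπ (fold v) ((hammingNorm_fold_le v).trans hv)
  have hfold : fold (v ∘ (dup π).trans (tau u)) = fold v ∘ π := by
    funext i
    simp only [fold, Function.comp_apply, Equiv.trans_apply, dup, tau,
      Function.Involutive.coe_toPerm, Equiv.sumCongr_apply, Sum.map_inl, Sum.map_inr, tauFun]
    split_ifs
    · rw [add_comm]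
    · rfl
  have hwt : wt (fun i => (v ∘ (dup π).trans (tau u)) (Sum.inr (Sum.inr i))) =
      wt (fun i => v (Sum.inr (Sum.inr i))) + dot u (fold v) := by
    simp only [wt, dot, ← Finset.sum_add_distrib]
    refine (Finset.sum_congr rfl fun i _ => ?_).trans (Equiv.sum_comp π
      fun i => v (Sum.inr (Sum.inr i)) + u i * fold v i)
    have hu : ∀ a : ZMod 2, a = 0 ∨ a = 1 := by decide
    have hab : ∀ a b : ZMod 2, a = b + (a + b) := by decide
    rcases hu (u (π i)) with hi | hi
    · simp [dup, tau, tauFun, hi]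
    · simpa [dup, tau, tauFun, fold, hi] using hab _ _
  rw [mem_vasiliev_iff, mem_vasiliev_iff, hfold, hwt, fold_add, h1]
  refine and_congr_right fun hmem => ?_
  have hl := h2 (h1.2 hmem)
  have hmid : (v ∘ (dup π).trans (tau u)) (Sum.inr (Sum.inl ())) = v (Sum.inr (Sum.inl ())) := rfl
  rw [hmid, wt_right_add, Pi.add_apply, hwb]
  have aux : ∀ a b c d e f g : ZMod 2, e + b = f + g →
    (a + b + c = a + d + e ↔ c = d + f + g) := by decide
  exact aux _ _ _ _ _ _ _ hl

theorem IsWitness.vasiliev_zero {C : Set (F ι)} (hC : IsWitness C) :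
    IsWitness (Vasiliev C 0) where
  zero_mem := by
    rw [mem_vasiliev_iff]
    refine ⟨?_, by simp [wt]⟩
    have : fold (0 : F (ι ⊕ Unit ⊕ ι)) = 0 := by funext i; simp [fold]
    rw [this]
    exact hC.zero_mem
  isPerfect := hC.isPerfect.vasiliev 0
  isLocallyHomogeneous := by
    refine IsLocallyHomogeneous.vasiliev fun y hy => ?_
    obtain ⟨π, hπ⟩ := hC.isLocallyHomogeneous y hy
    exact ⟨π, 0, fun z hz => ⟨hπ z hz, fun _ => by simp [dot]⟩⟩
  exists_quadruple := by
    have hlift : ∀ x : F ι, vasVec x 0 0 ∈ Vasiliev C 0 ↔ x ∈ C := by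
      intro x
      rw [mem_vasiliev_iff, fold_vasVec, add_zero]
      exact and_iff_left (by simp [vasVec, wt])
    have hadd : ∀ x y : F ι, vasVec x 0 0 + vasVec y 0 0 = vasVec (x + y) 0 0 := by
      intro x y
      funext i
      rcases i with i | i | i <;> simp [vasVec]
    obtain ⟨y, hy, T, hT, hT'⟩ := hC.exists_quadruple
    refine ⟨vasVec y 0 0, (hlift y).2 hy, fun i => vasVec (T i) 0 0, fun i => ⟨?_, ?_⟩,
      fun i j hij => ?_⟩
    · refine le_trans (le_of_eq ?_) (hT i).1
      have : (Finset.univ.filter fun j => vasVec (T i) 0 0 j ≠ 0) =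
          (Finset.univ.filter fun j => T i j ≠ 0).map Function.Embedding.inl := by
        ext j
        simp only [Finset.mem_filter, Finset.mem_univ, true_and, Finset.mem_map]
        rcases j with j | j | j <;> simp [vasVec]
      rw [hammingNorm, this, Finset.card_map, hammingNorm]
    · rw [hadd, hlift]; exact (hT i).2
    · rw [hadd, hadd, hlift]; exact hT' i j hij
  not_quadruple_zero := by
    rintro ⟨T, hT, hT'⟩
    simp only [zero_add, mem_vasiliev_iff] at hT hT'
    refine hC.not_quadruple_zero ⟨fun i => fold (T i), fun i => ⟨?_, ?_⟩, fun i j hij => ?_⟩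
    · exact (hammingNorm_fold_le _).trans (hT i).1
    · rw [zero_add]; exact (hT i).2.1
    · rw [zero_add]
      intro hc
      refine hT' i j hij ⟨by rwa [fold_add], ?_⟩
      rw [wt_right_add, Pi.add_apply, (hT i).2.2, (hT j).2.2]
      simp

end Vasiliev

section Base

/-- The Hamming code of length seven. -/
def hamming7 : Set (F (Fin 7)) :=
  {v | v 0 + v 2 + v 4 + v 6 = 0 ∧ v 1 + v 2 + v 5 + v 6 = 0 ∧ v 3 + v 4 + v 5 + v 6 = 0}

instance : DecidablePred (· ∈ hamming7) := fun _ =>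
  inferInstanceAs (Decidable (_ ∧ _ ∧ _))

/-- A cubic function, which is `v 0 * v 1` on vectors of even weight and `v 0 * v 3` on
vectors of odd weight. -/
def cubic7 (v : F (Fin 7)) : ZMod 2 := v 0 * (v 1 + wt v * (v 1 + v 3))

theorem isPerfect_hamming7 : IsPerfect hamming7 := by
  rw [isPerfect_iff]
  unfold ExistsUnique
  decide +kernel

theorem hamming7_add {x y : F (Fin 7)} (hx : x ∈ hamming7) : x + y ∈ hamming7 ↔ y ∈ hamming7 := by
  obtain ⟨h1, h2, h3⟩ := hx
  have aux : ∀ a b c d a' b' c' d' : ZMod 2, a + b + c + d = 0 →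
      (a + a' + (b + b') + (c + c') + (d + d') = 0 ↔ a' + b' + c' + d' = 0) := by decide
  simp only [hamming7, Set.mem_ofPred_eq, Pi.add_apply, aux _ _ _ _ _ _ _ _ h1,
    aux _ _ _ _ _ _ _ _ h2, aux _ _ _ _ _ _ _ _ h3]

theorem hamming7_light {z : F (Fin 7)} (hz : z ∈ hamming7) (h : hammingNorm z ≤ 3) :
    z = 0 ∨ wt z = 1 := by
  revert z
  unfold hammingNorm wt
  decide +kernel

/-- The collineation of the Fano plane exchanging two of the coordinate points. -/
def swap7 : Equiv.Perm (Fin 7) := Equiv.swap 1 3 * Equiv.swap 2 4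

theorem comp_swap7_mem {z : F (Fin 7)} : z ∘ swap7 ∈ hamming7 ↔ z ∈ hamming7 := by
  revert z
  decide +kernel

theorem cubic7_of_wt_eq_zero {v : F (Fin 7)} (h : wt v = 0) : cubic7 v = v 0 * v 1 := by
  simp [cubic7, h]

theorem cubic7_of_wt_eq_one {v : F (Fin 7)} (h : wt v = 1) : cubic7 v = v 0 * v 3 := by
  have aux : ∀ a b : ZMod 2, a + (a + b) = b := by decide
  rw [cubic7, h, one_mul, aux]

theorem cubic7_zero : cubic7 0 = 0 := zero_mul _

theorem dot_bilinear (a b c : ZMod 2) (m : Fin 7) (z : F (Fin 7)) :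
    dot (fun i => c + (if i = m then a else 0) + (if i = 0 then b else 0)) z =
      c * wt z + a * z m + b * z 0 := by
  simp [dot, wt, add_mul, Finset.sum_add_distrib, Finset.mul_sum]

/-- Up to linear functions, `cubic7` has around every vector the same values on light codewords,
up to the permutation `swap7`. -/
theorem exists_perm_cubic7 (y : F (Fin 7)) : ∃ (π : Equiv.Perm (Fin 7)) (u : F (Fin 7)),
    ∀ z, (z ∘ π ∈ hamming7 ↔ z ∈ hamming7) ∧
      (z = 0 ∨ wt z = 1 → cubic7 (y + z) + cubic7 y = dot u z + cubic7 (z ∘ π)) := by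
  have hwt : ∀ a : ZMod 2, a = 0 ∨ a = 1 := by decide
  have aux : ∀ y0 z0 ym zm l : ZMod 2,
    (y0 + z0) * (ym + zm) + l = (y0 * ym + l) * 1 + y0 * zm + ym * z0 + z0 * zm := by decide
  rcases hwt (wt y) with hy | hy
  · refine ⟨1, fun i => y 0 * y 3 + cubic7 y + (if i = 3 then y 0 else 0) +
      (if i = 0 then y 3 else 0), fun z => ⟨Iff.rfl, ?_⟩⟩
    rintro (rfl | hz)
    · simp [dot, CharTwo.add_self_eq_zero, cubic7_zero]
    · rw [cubic7_of_wt_eq_one (v := y + z) (by rw [wt_add, hy, hz]; rfl), dot_bilinear, hz,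
        Equiv.Perm.coe_one, Function.comp_id, cubic7_of_wt_eq_one hz]
      exact aux _ _ _ _ _
  · refine ⟨swap7, fun i => y 0 * y 1 + cubic7 y + (if i = 1 then y 0 else 0) +
      (if i = 0 then y 1 else 0), fun z => ⟨comp_swap7_mem, ?_⟩⟩
    rintro (rfl | hz)
    · simp [dot, CharTwo.add_self_eq_zero, cubic7_zero]
    · have hz' : wt (z ∘ swap7) = 1 := (Equiv.sum_comp swap7 z).trans hz
      rw [cubic7_of_wt_eq_zero (v := y + z) (by rw [wt_add, hy, hz]; rfl), dot_bilinear, hz,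
        cubic7_of_wt_eq_one hz']
      exact aux _ _ _ _ _

theorem cubic7_no_quadruple (T : Fin 4 → F (Fin 7)) (hT : ∀ i, T i = 0 ∨ wt (T i) = 1) :
    ∃ i j, i ≠ j ∧ cubic7 (T i + T j) = cubic7 (T i) + cubic7 (T j) := by
  by_contra! h
  have hne : ∀ i, wt (T i) = 1 := by
    intro i
    refine (hT i).resolve_left fun h0 => ?_
    obtain ⟨j, hj⟩ := exists_ne i
    exact h i j hj.symm (by rw [h0, zero_add, cubic7_zero, zero_add])
  have hedge : ∀ i j, i ≠ j →
      (T i 0 + T j 0) * (T i 1 + T j 1) ≠ T i 0 * T i 3 + T j 0 * T j 3 := by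
    intro i j hij
    have := h i j hij
    rwa [cubic7_of_wt_eq_one (hne i), cubic7_of_wt_eq_one (hne j),
      cubic7_of_wt_eq_zero (by rw [wt_add, hne, hne]; rfl)] at this
  have aux : ∀ a b c a' b' c' : ZMod 2, (a + a') * (b + b') ≠ a * c + a' * c' →
      ∀ a'' b'' c'' : ZMod 2, (a + a'') * (b + b'') ≠ a * c + a'' * c'' →
      (a' + a'') * (b' + b'') ≠ a' * c' + a'' * c'' →
      ∀ d e f : ZMod 2, (a + d) * (b + e) ≠ a * c + d * f →
      (a' + d) * (b' + e) ≠ a' * c' + d * f → ¬ (a'' + d) * (b'' + e) ≠ a'' * c'' + d * f := by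
    decide +kernel
  exact aux _ _ _ _ _ _ (hedge 0 1 (by decide)) _ _ _ (hedge 0 2 (by decide))
    (hedge 1 2 (by decide)) _ _ _ (hedge 0 3 (by decide)) (hedge 1 3 (by decide))
    (hedge 2 3 (by decide))

theorem isWitness_vasiliev_hamming7 : IsWitness (Vasiliev hamming7 cubic7) where
  zero_mem := ⟨0, 0, by decide, by decide⟩
  isPerfect := isPerfect_hamming7.vasiliev _
  isLocallyHomogeneous := by
    refine IsLocallyHomogeneous.vasiliev fun y hy => ?_
    obtain ⟨π, u, h⟩ := exists_perm_cubic7 y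
    refine ⟨π, u, fun z hz => ⟨(hamming7_add hy).trans (h z).1.symm, fun hyz => (h z).2 ?_⟩⟩
    exact hamming7_light ((hamming7_add hy).1 hyz) hz
  exists_quadruple := by
    refine ⟨vasVec (fun _ => 1) 1 0, ?_, ![
      vasVec ![0, 0, 0, 0, 1, 0, 1] 0 ![0, 1, 0, 0, 0, 0, 0],
      vasVec ![0, 0, 0, 1, 0, 1, 0] 0 ![0, 1, 0, 0, 0, 0, 0],
      vasVec ![0, 0, 0, 0, 0, 1, 1] 0 ![1, 0, 0, 0, 0, 0, 0],
      vasVec ![0, 0, 0, 1, 1, 0, 0] 0 ![1, 0, 0, 0, 0, 0, 0]], ?_, ?_⟩ <;>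
    · simp only [mem_vasiliev_iff]
      decide +kernel
  not_quadruple_zero := by
    rintro ⟨T, hT, hT'⟩
    simp only [zero_add, mem_vasiliev_iff] at hT hT'
    obtain ⟨i, j, hij, h⟩ := cubic7_no_quadruple (fun i => fold (T i)) fun i =>
      hamming7_light (hT i).2.1 ((hammingNorm_fold_le _).trans (hT i).1)
    refine hT' i j hij ⟨by rw [fold_add, hamming7_add (hT i).2.1]; exact (hT j).2.1, ?_⟩
    rw [wt_right_add, Pi.add_apply, (hT i).2.2, (hT j).2.2, fold_add, h]
    ring

theorem exists_isWitness (k : ℕ) (hk : 4 ≤ k) :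
    ∀ n, n + 1 = 2 ^ k → ∃ C : Set (F (Fin n)), IsWitness C := by
  induction k, hk using Nat.le_induction with
  | base =>
    intro n hn
    have hcard : Fintype.card (Fin 7 ⊕ Unit ⊕ Fin 7) = n := by
      simp only [Fintype.card_sum, Fintype.card_fin, Fintype.card_unit]
      omega
    exact ⟨_, isWitness_vasiliev_hamming7.comp (Fintype.equivFinOfCardEq hcard)⟩
  | succ k hk ih =>
    intro n hn
    obtain ⟨m, hm⟩ : ∃ m, m + 1 = 2 ^ k := ⟨2 ^ k - 1, Nat.sub_add_cancel Nat.one_le_two_pow⟩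
    obtain ⟨C, hC⟩ := ih m hm
    have hcard : Fintype.card (Fin m ⊕ Unit ⊕ Fin m) = n := by
      simp only [Fintype.card_sum, Fintype.card_fin, Fintype.card_unit]
      rw [pow_succ] at hn
      omega
    exact ⟨_, hC.vasiliev_zero.comp (Fintype.equivFinOfCardEq hcard)⟩

end Base

/-- for every `n = 2^k - 1` with `n ≥ 15` there is a reduced perfect binary
code of length `n` that is homogeneous but not transitive. -/
theorem stmt0 (n k : ℕ) (hk : n + 1 = 2 ^ k) (hn : 15 ≤ n) :
    ∃ C : Set (F (Fin n)), (0 : F (Fin n)) ∈ C ∧ IsPerfect C ∧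
      IsHomogeneous C ∧ ¬ IsTransitive C := by
  have hk4 : 4 ≤ k := by
    by_contra! h
    have : 2 ^ k ≤ 2 ^ 3 := Nat.pow_le_pow_right (by norm_num) (by omega)
    omega
  obtain ⟨C, hC⟩ := exists_isWitness k hk4 n hk
  exact ⟨C, hC.zero_mem, hC.isPerfect, hC.isLocallyHomogeneous.isHomogeneous, hC.not_isTransitive⟩
end

section
/- Let C be a reduced perfect code of length n, λ: C → ZMod 2 with λ(0^n) = 0, y' ∈ C, and z = (y', λ(y'), 0^n) ∈ V_C^λ. A permutation ρ ∈ S_{2n+1} fixing position n+1 satisfies z + ρ(V_C^λ) = V_C^λ if and only if ρ = σ_π ∘ τ_u for some π ∈ Rot_{y'}(C) and some u ∈ F^n such that for every y ∈ C, λ(y') + λ(y) + λ(y' + π(y)) = u·y. -/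
set_option linter.unusedSectionVars false

section VasilievRotations

variable {ι : Type*}

theorem binary_add_self (x : F ι) : x + x = 0 :=
  funext fun i => CharTwo.add_self_eq_zero (x i)

theorem eq_permAct_iff {π : Equiv.Perm ι} {x w : F ι} : w = permAct π x ↔ ∀ i, w (π i) = x i := by
  constructor
  · rintro rfl i
    simp [permAct]
  · intro h
    funext i
    simpa [permAct] using h (π.symm i)

theorem permAct_injective (π : Equiv.Perm ι) : Function.Injective (permAct π) :=
  π.symm.surjective.injective_comp_right

theorem permAct_add (π : Equiv.Perm ι) (x y : F ι) :
    permAct π (x + y) = permAct π x + permAct π y := rfl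

theorem permAct_single [DecidableEq ι] (π : Equiv.Perm ι) (i : ι) (b : ZMod 2) :
    permAct π (Pi.single i b) = Pi.single (π i) b := by
  symm
  rw [eq_permAct_iff]
  intro j
  simp [Pi.single_apply]

theorem translateCode_permCode_eq_iff [Finite ι] (C : Set (F ι)) (y : F ι)
    (π : Equiv.Perm ι) :
    translateCode y (permCode π C) = C ↔ ∀ x ∈ C, y + permAct π x ∈ C := by
  have hinj : Function.Injective fun x => y + permAct π x :=
    (add_right_injective y).comp (permAct_injective π)
  have himg : translateCode y (permCode π C) = (fun x => y + permAct π x) '' C :=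
    Set.image_image _ _ _
  rw [himg]
  constructor
  · intro h x hx
    exact h.subset (Set.mem_image_of_mem _ hx)
  · intro h
    refine Set.eq_of_subset_of_ncard_le (Set.image_subset_iff.2 h) ?_ (Set.toFinite C)
    rw [Set.ncard_image_of_injective C hinj]

theorem vasVec_mem_Vasiliev_iff [Fintype ι] {C : Set (F ι)} {lam : F ι → ZMod 2} {a c : F ι}
    {b : ZMod 2} :
    vasVec a b c ∈ Vasiliev C lam ↔ a + c ∈ C ∧ b = wt c + lam (a + c) := by
  constructor
  · rintro ⟨x, y, hy, h⟩
    have ha : a = x + y := funext fun i => congrFun h (Sum.inl i)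
    have hb : b = wt x + lam y := congrFun h (Sum.inr (Sum.inl ()))
    have hc : c = x := funext fun i => congrFun h (Sum.inr (Sum.inr i))
    subst ha hb hc
    have hxy : c + y + c = y := by rw [add_right_comm, binary_add_self, zero_add]
    rw [hxy]
    exact ⟨hy, rfl⟩
  · rintro ⟨hac, rfl⟩
    refine ⟨c, a + c, hac, ?_⟩
    rw [add_left_comm, binary_add_self, add_zero]

theorem vasVec_add (a a' : F ι) (b b' : ZMod 2) (c c' : F ι) :
    vasVec a b c + vasVec a' b' c' = vasVec (a + a') (b + b') (c + c') := by
  funext p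
  rcases p with i | _ | i <;> rfl

theorem permAct_dup_mul_tau [Fintype ι] [DecidableEq ι] (π : Equiv.Perm ι) (u a c : F ι) (b : ZMod 2) :
    permAct (dup π * tau u) (vasVec a b c) =
      vasVec (permAct π (a + u * (a + c))) b (permAct π (c + u * (a + c))) := by
  symm
  rw [eq_permAct_iff]
  have hu (i : ι) : u i = 0 ∨ u i = 1 := by generalize u i = t; revert t; decide
  have hs (s t : ZMod 2) : t + (s + t) = s := by rw [add_comm s, CharTwo.add_cancel_left]
  rintro (i | _ | i)
  · rcases hu i with h | h <;> simp [dup, tau, tauFun, vasVec, permAct, h, hs]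
  · rfl
  · rcases hu i with h | h <;> simp [dup, tau, tauFun, vasVec, permAct, h, CharTwo.add_cancel_left]

theorem wt_permAct [Fintype ι] (π : Equiv.Perm ι) (x : F ι) : wt (permAct π x) = wt x :=
  Equiv.sum_comp π.symm x

theorem wt_add_mul [Fintype ι] (c u y : F ι) : wt (c + u * y) = wt c + dot u y :=
  Finset.sum_add_distrib

theorem translate_permAct_mem_Vasiliev_iff [Fintype ι] [DecidableEq ι] {C : Set (F ι)}
    {lam : F ι → ZMod 2} (π : Equiv.Perm ι) (u y' a c : F ι) (t b : ZMod 2) :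
    vasVec y' t 0 + permAct (dup π * tau u) (vasVec a b c) ∈ Vasiliev C lam ↔
      y' + permAct π (a + c) ∈ C ∧
        t + b = wt c + dot u (a + c) + lam (y' + permAct π (a + c)) := by
  have h : y' + permAct π (a + u * (a + c)) + (0 + permAct π (c + u * (a + c))) =
      y' + permAct π (a + c) := by
    rw [zero_add, add_assoc, ← permAct_add, add_add_add_comm, binary_add_self, add_zero]
  rw [permAct_dup_mul_tau, vasVec_add, vasVec_mem_Vasiliev_iff, h, zero_add, wt_permAct,
    wt_add_mul]

theorem IsPerfect.eq_of_add_single_add_single_mem [Fintype ι] [DecidableEq ι] {C : Set (F ι)}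
    (hC : IsPerfect C) {y : F ι} (hy : y ∈ C) {j k : ι}
    (h : y + (Pi.single j 1 + Pi.single k 1) ∈ C) : j = k := by
  have hd (x : F ι) (l : ι) : hammingDist x (x + Pi.single l 1) ≤ 1 := by
    refine (Finset.card_le_card (t := {l}) fun i hi => ?_).trans_eq (Finset.card_singleton l)
    by_contra hil
    simp_all
  have hfst : hammingDist (y + Pi.single j 1) y ≤ 1 := by
    rw [hammingDist_comm]
    exact hd y j
  have hsnd : hammingDist (y + Pi.single j 1) (y + (Pi.single j 1 + Pi.single k 1)) ≤ 1 := by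
    rw [← add_assoc]
    exact hd _ k
  have heq := (hC (y + Pi.single j 1)).unique ⟨h, hsnd⟩ ⟨hy, hfst⟩
  rw [add_eq_left] at heq
  by_contra hjk
  simpa [hjk] using congrFun heq j

theorem exists_dup_mul_tau_of_swaps_pairs [Fintype ι] [DecidableEq ι]
    {ρ : Equiv.Perm (ι ⊕ Unit ⊕ ι)}
    (hfix : ρ (Sum.inr (Sum.inl ())) = Sum.inr (Sum.inl ()))
    (h : ∀ i, ∃ j, (ρ (Sum.inl i) = Sum.inl j ∧ ρ (Sum.inr (Sum.inr i)) = Sum.inr (Sum.inr j)) ∨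
      (ρ (Sum.inl i) = Sum.inr (Sum.inr j) ∧ ρ (Sum.inr (Sum.inr i)) = Sum.inl j)) :
    ∃ (π : Equiv.Perm ι) (u : F ι), ρ = dup π * tau u := by
  choose f hf using h
  have hinj : Function.Injective f := by
    intro i j hij
    have hj := hf j
    rw [← hij] at hj
    rcases hf i with ⟨h1, h2⟩ | ⟨h1, h2⟩ <;> rcases hj with ⟨h3, h4⟩ | ⟨h3, h4⟩
    · simpa using ρ.injective (h1.trans h3.symm)
    · simpa using ρ.injective (h1.trans h4.symm)
    · simpa using ρ.injective (h1.trans h4.symm)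
    · simpa using ρ.injective (h1.trans h3.symm)
  refine ⟨Equiv.ofBijective f (Finite.injective_iff_bijective.1 hinj),
    fun i => if ρ (Sum.inl i) = Sum.inl (f i) then 0 else 1, Equiv.ext ?_⟩
  rintro (i | _ | i)
  · rcases hf i with ⟨h1, h2⟩ | ⟨h1, h2⟩ <;> simp [dup, tau, tauFun, h1]
  · exact hfix
  · rcases hf i with ⟨h1, h2⟩ | ⟨h1, h2⟩ <;> simp [dup, tau, tauFun, h1, h2]

theorem vasVec_single_eq [DecidableEq ι] (i : ι) :
    vasVec (Pi.single i 1) 1 (Pi.single i 1) =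
      (Pi.single (Sum.inl i) 1 + Pi.single (Sum.inr (Sum.inl ())) 1 +
        Pi.single (Sum.inr (Sum.inr i)) 1 : F (ι ⊕ Unit ⊕ ι)) := by
  funext p
  rcases p with j | _ | j <;> simp [vasVec, Pi.single_apply]

theorem single_inl_eq [DecidableEq ι] (i : ι) :
    (Pi.single (Sum.inl i) 1 : F (ι ⊕ Unit ⊕ ι)) = vasVec (Pi.single i 1) 0 0 := by
  funext p
  rcases p with j | _ | j <;> simp [vasVec, Pi.single_apply]

theorem single_mid_eq [DecidableEq ι] :
    (Pi.single (Sum.inr (Sum.inl ())) 1 : F (ι ⊕ Unit ⊕ ι)) = vasVec 0 1 0 := by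
  funext p
  rcases p with j | _ | j <;> simp [vasVec]

theorem single_inr_eq [DecidableEq ι] (i : ι) :
    (Pi.single (Sum.inr (Sum.inr i)) 1 : F (ι ⊕ Unit ⊕ ι)) = vasVec 0 0 (Pi.single i 1) := by
  funext p
  rcases p with j | _ | j <;> simp [vasVec, Pi.single_apply]

theorem IsPerfect.swaps_pairs_of_translate_mem [Fintype ι] [DecidableEq ι] {C : Set (F ι)}
    (h0 : (0 : F ι) ∈ C) (hC : IsPerfect C) {lam : F ι → ZMod 2} (hlam : lam 0 = 0)
    {y' : F ι} (hy' : y' ∈ C) {t : ZMod 2} {ρ : Equiv.Perm (ι ⊕ Unit ⊕ ι)}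
    (hfix : ρ (Sum.inr (Sum.inl ())) = Sum.inr (Sum.inl ()))
    (h : ∀ v ∈ Vasiliev C lam, vasVec y' t 0 + permAct ρ v ∈ Vasiliev C lam) (i : ι) :
    ∃ j, (ρ (Sum.inl i) = Sum.inl j ∧ ρ (Sum.inr (Sum.inr i)) = Sum.inr (Sum.inr j)) ∨
      (ρ (Sum.inl i) = Sum.inr (Sum.inr j) ∧ ρ (Sum.inr (Sum.inr i)) = Sum.inl j) := by
  have hmem : vasVec (Pi.single i 1) 1 (Pi.single i 1) ∈ Vasiliev C lam := by
    rw [vasVec_mem_Vasiliev_iff, binary_add_self, hlam]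
    exact ⟨h0, by simp [wt]⟩
  have himg := h _ hmem
  rw [vasVec_single_eq, permAct_add, permAct_add, permAct_single, permAct_single, permAct_single,
    hfix] at himg
  have hne : ρ (Sum.inl i) ≠ ρ (Sum.inr (Sum.inr i)) := by simp
  have hp : ρ (Sum.inl i) ≠ Sum.inr (Sum.inl ()) := by
    rw [← hfix]
    simp
  have hq : ρ (Sum.inr (Sum.inr i)) ≠ Sum.inr (Sum.inl ()) := by
    intro hmid
    simpa using ρ.injective (hmid.trans hfix.symm)
  generalize ρ (Sum.inl i) = p at *
  generalize ρ (Sum.inr (Sum.inr i)) = q at *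
  rcases p with j | _ | j
  · rcases q with k | _ | k
    all_goals simp only [single_inl_eq, single_mid_eq, single_inr_eq, vasVec_add,
      vasVec_mem_Vasiliev_iff, add_zero, zero_add] at himg
    · exact (hne (congrArg _ (hC.eq_of_add_single_add_single_mem hy' himg.1))).elim
    · exact (hq rfl).elim
    · rw [add_assoc] at himg
      have hjk := hC.eq_of_add_single_add_single_mem hy' himg.1
      exact ⟨j, Or.inl ⟨rfl, by rw [hjk]⟩⟩
  · exact (hp rfl).elim
  · rcases q with k | _ | k
    all_goals simp only [single_inl_eq, single_mid_eq, single_inr_eq, vasVec_add,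
      vasVec_mem_Vasiliev_iff, add_zero, zero_add] at himg
    · rw [add_assoc] at himg
      have hkj := hC.eq_of_add_single_add_single_mem hy' himg.1
      exact ⟨j, Or.inr ⟨rfl, by rw [hkj]⟩⟩
    · exact (hq rfl).elim
    · have hjk := hC.eq_of_add_single_add_single_mem hy' himg.1
      exact (hne (by rw [hjk])).elim

end VasilievRotations

/-- characterization of the permutations `ρ` fixing position `n+1` with
`z + ρ(V_C^λ) = V_C^λ`, for `z = (y', λ(y'), 0^n)`. -/
theorem stmt2 {n : ℕ} (C : Set (F (Fin n))) (h0 : (0 : F (Fin n)) ∈ C)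
    (hC : IsPerfect C) (lam : F (Fin n) → ZMod 2) (hlam : lam 0 = 0)
    (y' : F (Fin n)) (hy' : y' ∈ C) (ρ : Equiv.Perm (Fin n ⊕ Unit ⊕ Fin n))
    (hfix : ρ (Sum.inr (Sum.inl ())) = Sum.inr (Sum.inl ())) :
    translateCode (vasVec y' (lam y') 0) (permCode ρ (Vasiliev C lam)) = Vasiliev C lam ↔
      ∃ π ∈ RotAt C y', ∃ u : F (Fin n), ρ = dup π * tau u ∧
        ∀ y ∈ C, lam y' + lam y + lam (y' + permAct π y) = dot u y := by
  rw [translateCode_permCode_eq_iff]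
  constructor
  · intro h
    obtain ⟨π, u, rfl⟩ := exists_dup_mul_tau_of_swaps_pairs hfix
      (hC.swaps_pairs_of_translate_mem h0 hlam hy' hfix h)
    have key (y : F (Fin n)) (hy : y ∈ C) :
        y' + permAct π y ∈ C ∧ lam y' + lam y = dot u y + lam (y' + permAct π y) := by
      have hmem : vasVec y (lam y) 0 ∈ Vasiliev C lam := by
        rw [vasVec_mem_Vasiliev_iff]
        simp [hy, wt]
      simpa [wt] using (translate_permAct_mem_Vasiliev_iff π u y' y 0 _ _).1 (h _ hmem)
    refine ⟨π, (translateCode_permCode_eq_iff C y' π).2 fun y hy => (key y hy).1, u, rfl,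
      fun y hy => ?_⟩
    rw [(key y hy).2, CharTwo.add_cancel_right]
  · rintro ⟨π, hπ, u, rfl, hu⟩ v ⟨x, y, hy, rfl⟩
    have hxy : x + y + x = y := by rw [add_right_comm, binary_add_self, zero_add]
    rw [translate_permAct_mem_Vasiliev_iff, hxy, ← hu y hy, add_assoc (wt x),
      CharTwo.add_cancel_right]
    exact ⟨(translateCode_permCode_eq_iff C y' π).1 hπ y hy, add_left_comm _ _ _⟩
end
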